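/- arXiv:1307.5138 — 2 statements merged into one kernel-verified Lean document; each statement's English description precedes it below -/
import Mathlib

section
/- Let Δ = conv{a_0,…,a_d} ⊂ ℝ^d be a non-degenerate simplex with barycenter at the origin. Then the modified illumination complex B(Δ, {0,1}) with the two-element color set is homeomorphic to the d-dimensional sphere S^d (the unit sphere in ℝ^{d+1}). -/
noncomputable section

/-- The facet `F i = conv {a j : j ≠ i}` of the simplex with vertex set `a`,
opposite the vertex `a i`. -/
def facet {d : ℕ} (a : Fin (d + 1) → EuclideanSpace ℝ (Fin d)) (i : Fin (d + 1)) :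
    Set (EuclideanSpace ℝ (Fin d)) :=
  convexHull ℝ (a '' {j | j ≠ i})

/-- The identification generating the modified illumination complex `B(Δ, S)`:
`(x, f) ∼ (x, g)` iff `f i = g i` for every `i` with `x ∉ F i`. -/
def BRel {d : ℕ} (a : Fin (d + 1) → EuclideanSpace ℝ (Fin d)) (S : Type*)
    (p q : ↥(convexHull ℝ (Set.range a)) × (Fin (d + 1) → S)) : Prop :=
  p.1 = q.1 ∧ ∀ i : Fin (d + 1), (p.1 : EuclideanSpace ℝ (Fin d)) ∉ facet a i →
    p.2 i = q.2 i

/-- The modified illumination complex `B(Δ, S) = (Δ × Fun({0,…,d}, S)) / ∼`,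
with the quotient topology. -/
abbrev BComplex {d : ℕ} (a : Fin (d + 1) → EuclideanSpace ℝ (Fin d)) (S : Type*) :=
  Quot (BRel a S)

/-- The affine basis formed by the vertices of a non-degenerate simplex. -/
def simplexBasis {d : ℕ} (a : Fin (d + 1) → EuclideanSpace ℝ (Fin d))
    (hnondeg : LinearIndependent ℝ (fun i : Fin d => a i.succ - a 0)) :
    AffineBasis (Fin (d + 1)) ℝ (EuclideanSpace ℝ (Fin d)) :=
  have hind : AffineIndependent ℝ a := by
    rw [affineIndependent_iff_linearIndependent_vsub ℝ a 0,
      ← linearIndependent_equiv (finSuccAboveEquiv (0 : Fin (d + 1)))]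
    exact hnondeg
  ⟨a, hind, by
    rw [hind.affineSpan_eq_top_iff_card_eq_finrank_add_one]
    simp⟩

theorem coord_nonneg_of_mem_convexHull {d : ℕ}
    (b : AffineBasis (Fin (d + 1)) ℝ (EuclideanSpace ℝ (Fin d)))
    {x : EuclideanSpace ℝ (Fin d)} (hx : x ∈ convexHull ℝ (Set.range b)) (i : Fin (d + 1)) :
    0 ≤ b.coord i x := by
  rw [b.convexHull_eq_nonneg_coord] at hx
  exact hx i

theorem mem_facet_iff_coord_eq_zero {d : ℕ}
    (b : AffineBasis (Fin (d + 1)) ℝ (EuclideanSpace ℝ (Fin d)))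
    {x : EuclideanSpace ℝ (Fin d)} (hx : ∀ i, 0 ≤ b.coord i x) (i : Fin (d + 1)) :
    x ∈ facet b i ↔ b.coord i x = 0 := by
  constructor
  · intro h
    have hconv : Convex ℝ (b.coord i ⁻¹' {0}) := (convex_singleton 0).affine_preimage _
    refine convexHull_min ?_ hconv h
    rintro _ ⟨j, hj, rfl⟩
    exact b.coord_apply_ne (Ne.symm hj)
  · intro h
    have hsum : ∑ j ∈ Finset.univ.erase i, b.coord j x = 1 := by
      rw [Finset.sum_erase (f := fun j => b.coord j x) Finset.univ h, b.sum_coord_apply_eq_one]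
    have hcomb : ∑ j ∈ Finset.univ.erase i, b.coord j x • b j = x := by
      rw [Finset.sum_erase _ (by simp [h]), b.linear_combination_coord_eq_self]
    rw [← hcomb]
    exact (convex_convexHull ℝ _).sum_mem (fun j _ => hx j) hsum fun j hj =>
      subset_convexHull ℝ _ ⟨j, (Finset.mem_erase.mp hj).1, rfl⟩

/-- The sign attached to one of two colors. -/
def colorSign (c : Fin 2) : ℝ := if c = 0 then 1 else -1

theorem colorSign_sq (c : Fin 2) : colorSign c ^ 2 = 1 := by
  unfold colorSign
  split_ifs <;> norm_num

theorem colorSign_mul_inj {c c' : Fin 2} {r s : ℝ} (hr : 0 ≤ r) (hs : 0 ≤ s)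
    (h : colorSign c * r = colorSign c' * s) : r = s ∧ (r ≠ 0 → c = c') := by
  have hrs : r = s := by
    rw [← abs_of_nonneg hr, ← abs_of_nonneg hs, ← sq_eq_sq_iff_abs_eq_abs]
    have h2 : (colorSign c * r) ^ 2 = (colorSign c' * s) ^ 2 := by rw [h]
    simpa only [mul_pow, colorSign_sq, one_mul] using h2
  refine ⟨hrs, fun hr0 => ?_⟩
  subst hrs
  have hc := mul_right_cancel₀ hr0 h
  revert hc
  fin_cases c <;> fin_cases c' <;> norm_num [colorSign]

/-- The square roots of the barycentric coordinates of a point of the simplex, with signs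
prescribed by a two-coloring. -/
def signedSqrtCoord {d : ℕ} (b : AffineBasis (Fin (d + 1)) ℝ (EuclideanSpace ℝ (Fin d)))
    (p : ↥(convexHull ℝ (Set.range b)) × (Fin (d + 1) → Fin 2)) :
    Metric.sphere (0 : EuclideanSpace ℝ (Fin (d + 1))) 1 :=
  ⟨WithLp.toLp 2 fun i => colorSign (p.2 i) * √(b.coord i p.1), by
    have hp := coord_nonneg_of_mem_convexHull b p.1.2
    have hsq : ∀ i, √(b.coord i p.1) ^ 2 = b.coord i p.1 := fun i => Real.sq_sqrt (hp i)
    simp [EuclideanSpace.norm_eq, mul_pow, colorSign_sq, hsq, b.sum_coord_apply_eq_one]⟩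

theorem continuous_signedSqrtCoord {d : ℕ}
    (b : AffineBasis (Fin (d + 1)) ℝ (EuclideanSpace ℝ (Fin d))) :
    Continuous (signedSqrtCoord b) := by
  refine Continuous.subtype_mk ((PiLp.continuous_toLp 2 _).comp (continuous_pi fun i => ?_)) _
  have hsign : Continuous colorSign := continuous_of_discreteTopology
  have hcoord : Continuous (b.coord i) := (b.coord i).continuous_of_finiteDimensional
  fun_prop

theorem signedSqrtCoord_surjective {d : ℕ}
    (b : AffineBasis (Fin (d + 1)) ℝ (EuclideanSpace ℝ (Fin d))) :
    Function.Surjective (signedSqrtCoord b) := by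
  rintro ⟨y, hy⟩
  have hy1 : ∑ i, y i ^ 2 = 1 := by
    rw [mem_sphere_zero_iff_norm] at hy
    rw [← EuclideanSpace.real_norm_sq_eq, hy, one_pow]
  set x := Finset.univ.affineCombination ℝ b fun i => y i ^ 2
  have hcoord : ∀ i, b.coord i x = y i ^ 2 := fun i =>
    b.coord_apply_combination_of_mem (Finset.mem_univ i) hy1
  have hx : x ∈ convexHull ℝ (Set.range b) := by
    rw [b.convexHull_eq_nonneg_coord]
    intro i
    rw [hcoord]
    positivity
  refine ⟨⟨⟨x, hx⟩, fun i => if 0 ≤ y i then 0 else 1⟩, Subtype.ext ?_⟩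
  ext i
  simp only [signedSqrtCoord, hcoord, Real.sqrt_sq_eq_abs, colorSign]
  split_ifs with h
  · simp [abs_of_nonneg h]
  · simp_all
  · simp_all
  · simp [abs_of_neg (not_le.mp h)]

theorem signedSqrtCoord_eq_iff {d : ℕ}
    (b : AffineBasis (Fin (d + 1)) ℝ (EuclideanSpace ℝ (Fin d)))
    (p q : ↥(convexHull ℝ (Set.range b)) × (Fin (d + 1) → Fin 2)) :
    signedSqrtCoord b p = signedSqrtCoord b q ↔ BRel b (Fin 2) p q := by
  have hnonneg : ∀ x : ↥(convexHull ℝ (Set.range b)), ∀ i, 0 ≤ b.coord i x := fun x =>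
    coord_nonneg_of_mem_convexHull b x.2
  constructor
  · intro h
    have hi : ∀ i, √(b.coord i p.1) = √(b.coord i q.1) ∧
        (√(b.coord i p.1) ≠ 0 → p.2 i = q.2 i) := fun i =>
      colorSign_mul_inj (Real.sqrt_nonneg _) (Real.sqrt_nonneg _)
        (congrArg (fun y : Metric.sphere (0 : EuclideanSpace ℝ (Fin (d + 1))) 1 =>
          (y : EuclideanSpace ℝ (Fin (d + 1))) i) h)
    refine ⟨Subtype.ext (b.ext_elem fun i => ?_), fun i hpi => (hi i).2 fun h0 => hpi ?_⟩
    · exact (Real.sqrt_inj (hnonneg _ i) (hnonneg _ i)).mp (hi i).1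
    · rw [mem_facet_iff_coord_eq_zero b (hnonneg p.1)]
      exact (Real.sqrt_eq_zero (hnonneg _ i)).mp h0
  · rintro ⟨h1, h2⟩
    refine Subtype.ext ?_
    ext i
    by_cases hi : (p.1 : EuclideanSpace ℝ (Fin d)) ∈ facet b i
    · rw [mem_facet_iff_coord_eq_zero b (hnonneg p.1)] at hi
      simp [signedSqrtCoord, ← h1, hi]
    · simp [signedSqrtCoord, ← h1, h2 i hi]

theorem nonempty_BComplex_homeomorph_sphere {d : ℕ}
    (b : AffineBasis (Fin (d + 1)) ℝ (EuclideanSpace ℝ (Fin d))) :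
    Nonempty (BComplex b (Fin 2) ≃ₜ
      Metric.sphere (0 : EuclideanSpace ℝ (Fin (d + 1))) 1) := by
  have : CompactSpace ↥(convexHull ℝ (Set.range b)) :=
    isCompact_iff_compactSpace.mp ((Set.finite_range b).isCompact_convexHull ℝ)
  let φ : BComplex b (Fin 2) → Metric.sphere (0 : EuclideanSpace ℝ (Fin (d + 1))) 1 :=
    Quot.lift (signedSqrtCoord b) fun p q => (signedSqrtCoord_eq_iff b p q).mpr
  have hcont : Continuous φ := continuous_quot_lift _ (continuous_signedSqrtCoord b)
  have hbij : Function.Bijective φ := by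
    refine ⟨?_, fun y => ?_⟩
    · rintro ⟨p⟩ ⟨q⟩ h
      exact Quot.sound ((signedSqrtCoord_eq_iff b p q).mp h)
    · obtain ⟨p, hp⟩ := signedSqrtCoord_surjective b y
      exact ⟨Quot.mk _ p, hp⟩
  exact ⟨Continuous.homeoOfEquivCompactToT2 (f := Equiv.ofBijective φ hbij) hcont⟩

/-- For a non-degenerate simplex `Δ ⊂ ℝ^d` with barycenter at the origin, the
modified illumination complex `B(Δ, {0,1})` with two colors is homeomorphic to the
`d`-sphere (the unit sphere in `ℝ^{d+1}`). -/
theorem BComplex_two_colors_homeomorphic_sphere (d : ℕ)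
    (a : Fin (d + 1) → EuclideanSpace ℝ (Fin d))
    (hnondeg : LinearIndependent ℝ (fun i : Fin d => a i.succ - a 0))
    (hbary : ∑ i, a i = 0) :
    Nonempty (BComplex a (Fin 2) ≃ₜ
      (Metric.sphere (0 : EuclideanSpace ℝ (Fin (d + 1))) 1 :
        Set (EuclideanSpace ℝ (Fin (d + 1))))) := by
  exact nonempty_BComplex_homeomorph_sphere (simplexBasis a hnondeg)
end
end

section
/- Surjectivity of the illumination-volume map: Let Δ = conv{a_0,…,a_d} ⊂ ℝ^d be a non-degenerate simplex with barycenter at the origin and let R_Δ be the associated Δ-zonotope. Then for every vector (β_0,…,β_d) with β_i ≥ 0 for all i and β_0 + ⋯ + β_d = vol(R_Δ), there exists a point x ∈ R_Δ such that vol((x + cone(F_i)) ∩ R_Δ) = β_i for every i ∈ {0,…,d}. -/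
open MeasureTheory

noncomputable section

/-- The cone over the facet `F i = conv {a j | j ≠ i}` of the simplex with vertex
set `a`, with apex at the origin: `cone(F i) = {∑_{j ≠ i} t j • a j : t j ≥ 0}`. -/
def coneFace {d : ℕ} (a : Fin (d + 1) → EuclideanSpace ℝ (Fin d)) (i : Fin (d + 1)) :
    Set (EuclideanSpace ℝ (Fin d)) :=
  {z | ∃ t : Fin (d + 1) → ℝ, (∀ k, 0 ≤ t k) ∧ t i = 0 ∧ z = ∑ k, t k • a k}

/-- The Δ-zonotope `R_Δ = [0, a 0] + [0, a 1] + ⋯ + [0, a d]`, the Minkowski sum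
of the segments `[0, a i] = {t • a i : 0 ≤ t ≤ 1}`. -/
def zonotope {d : ℕ} (a : Fin (d + 1) → EuclideanSpace ℝ (Fin d)) :
    Set (EuclideanSpace ℝ (Fin d)) :=
  {z | ∃ t : Fin (d + 1) → ℝ, (∀ k, t k ∈ Set.Icc (0 : ℝ) 1) ∧ z = ∑ k, t k • a k}

/-- Coordinates on `ℝ^d` with respect to the vertices of a non-degenerate simplex centred at the
origin; the coefficients of a vector are unique up to adding a common constant. -/
lemma exists_vertex_coordinates {d : ℕ} {a : Fin (d + 1) → EuclideanSpace ℝ (Fin d)}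
    (hnondeg : LinearIndependent ℝ (fun i : Fin d => a i.succ - a 0)) (hbary : ∑ i, a i = 0) :
    ∃ τ : EuclideanSpace ℝ (Fin d) →ₗ[ℝ] (Fin (d + 1) → ℝ),
      (∀ z, ∑ k, τ z k • a k = z) ∧
      ∀ (t : Fin (d + 1) → ℝ) (i j), τ (∑ k, t k • a k) i - τ (∑ k, t k • a k) j = t i - t j := by
  let b := Module.Basis.mk hnondeg
    (hnondeg.span_eq_top_of_card_eq_finrank' (by simp)).ge
  have hb : ∀ i, b i = a i.succ - a 0 := fun i => by simp [b]
  let τ : EuclideanSpace ℝ (Fin d) →ₗ[ℝ] (Fin (d + 1) → ℝ) :=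
    LinearMap.pi (Fin.cons (-∑ i, b.coord i) fun i => b.coord i)
  have h0 : ∀ z, τ z 0 = -∑ i, b.repr z i := fun z => by simp [τ]
  have hs : ∀ z (i : Fin d), τ z i.succ = b.repr z i := fun z i => by simp [τ]
  have hτ : ∀ z, ∑ k, τ z k • a k = z := fun z => by
    conv_rhs => rw [← b.sum_repr z]
    simp only [Fin.sum_univ_succ, h0, hs, hb, smul_sub, Finset.sum_sub_distrib, neg_smul,
      Finset.sum_smul]
    abel
  refine ⟨τ, hτ, fun t => ?_⟩
  set z := ∑ k, t k • a k with hz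
  let s : Fin (d + 1) → ℝ := fun k => τ z k - t k
  have hsa : ∑ k, s k • a k = 0 := by
    simp only [s, sub_smul, Finset.sum_sub_distrib, hτ, ← hz, sub_self]
  have hconst : ∃ c, ∀ k, s k = c := by
    refine ⟨(∑ k, s k) / (d + 1), ?_⟩
    set c := (∑ k, s k) / (d + 1) with hc
    have hsum : ∑ k, (s k - c) = 0 := by
      have : (d + 1 : ℝ) ≠ 0 := by positivity
      simp only [Finset.sum_sub_distrib, Finset.sum_const, Finset.card_univ, Fintype.card_fin,
        nsmul_eq_mul, hc]
      push_cast
      field_simp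
      ring
    have hsuma : ∑ k, (s k - c) • a k = 0 := by
      simp only [sub_smul, Finset.sum_sub_distrib, hsa, ← Finset.smul_sum, hbary, smul_zero,
        sub_self]
    have hzero : ∑ i : Fin d, (s i.succ - c) • (a i.succ - a 0) = 0 := by
      rw [Fin.sum_univ_succ] at hsum hsuma
      rw [eq_neg_of_add_eq_zero_left hsum] at hsuma
      rw [← hsuma]
      simp only [smul_sub, Finset.sum_sub_distrib, ← Finset.sum_smul]
      module
    have hsucc := Fintype.linearIndependent_iff.mp hnondeg (fun i => s i.succ - c) hzero
    rw [Fin.sum_univ_succ] at hsum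
    intro k
    refine Fin.cases ?_ (fun i => ?_) k
    · simp only [hsucc, Finset.sum_const_zero, add_zero] at hsum
      linarith
    · linarith [hsucc i]
  obtain ⟨c, hc⟩ := hconst
  intro i j
  have hi := hc i
  have hj := hc j
  simp only [s] at hi hj
  linarith

lemma isCompact_zonotope {d : ℕ} (a : Fin (d + 1) → EuclideanSpace ℝ (Fin d)) :
    IsCompact (zonotope a) := by
  have h : zonotope a =
      (fun t : Fin (d + 1) → ℝ => ∑ k, t k • a k) '' Set.univ.pi fun _ => Set.Icc 0 1 := by
    ext z
    simp only [zonotope, Set.mem_ofPred_eq, Set.mem_image, Set.mem_pi, Set.mem_univ, true_imp_iff]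
    exact exists_congr fun t => and_congr_right fun _ => eq_comm
  rw [h]
  exact (isCompact_univ_pi fun _ => isCompact_Icc).image (by fun_prop)

section Coordinates

variable {d : ℕ} {a : Fin (d + 1) → EuclideanSpace ℝ (Fin d)}
  {τ : EuclideanSpace ℝ (Fin d) →ₗ[ℝ] (Fin (d + 1) → ℝ)}

lemma sum_sub_smul_vertices (hbary : ∑ i, a i = 0) (hτ : ∀ z, ∑ k, τ z k • a k = z)
    (z : EuclideanSpace ℝ (Fin d)) (c : ℝ) : ∑ k, (τ z k - c) • a k = z := by
  simp only [sub_smul, Finset.sum_sub_distrib, hτ, ← Finset.smul_sum, hbary, smul_zero, sub_zero]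

lemma mem_zonotope_iff (hbary : ∑ i, a i = 0) (hτ : ∀ z, ∑ k, τ z k • a k = z)
    (hdiff : ∀ (t : Fin (d + 1) → ℝ) (i j),
      τ (∑ k, t k • a k) i - τ (∑ k, t k • a k) j = t i - t j)
    {z : EuclideanSpace ℝ (Fin d)} : z ∈ zonotope a ↔ ∀ i j, τ z i - τ z j ≤ 1 := by
  constructor
  · rintro ⟨t, ht, rfl⟩ i j
    rw [hdiff]
    linarith [(ht i).2, (ht j).1]
  · intro h
    obtain ⟨m, hm⟩ := Finite.exists_min (τ z)
    exact ⟨fun k => τ z k - τ z m, fun k => ⟨sub_nonneg.mpr (hm k), h k m⟩,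
      (sum_sub_smul_vertices hbary hτ z _).symm⟩

lemma mem_translate_coneFace_iff (hbary : ∑ i, a i = 0) (hτ : ∀ z, ∑ k, τ z k • a k = z)
    (hdiff : ∀ (t : Fin (d + 1) → ℝ) (i j),
      τ (∑ k, t k • a k) i - τ (∑ k, t k • a k) j = t i - t j)
    {x z : EuclideanSpace ℝ (Fin d)} {i : Fin (d + 1)} :
    z ∈ (x + ·) '' coneFace a i ↔ ∀ k, τ z i - τ x i ≤ τ z k - τ x k := by
  constructor
  · rintro ⟨_, ⟨t, ht, hti, rfl⟩, rfl⟩ k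
    have := hdiff t k i
    simp only [map_add, Pi.add_apply]
    linarith [ht k]
  · intro h
    refine ⟨z - x, ⟨fun k => τ (z - x) k - τ (z - x) i, fun k => ?_, sub_self _,
      (sum_sub_smul_vertices hbary hτ _ _).symm⟩, add_sub_cancel _ _⟩
    simpa using h k

/-- A point of the zonotope maximizing a concave (Kantorovich) functional illuminates, through the
face opposite `a q`, at most the prescribed volume `β q`, up to a margin `ε`. -/
lemma exists_forall_volume_margin_le (hbary : ∑ i, a i = 0) (hτ : ∀ z, ∑ k, τ z k • a k = z)
    (hdiff : ∀ (t : Fin (d + 1) → ℝ) (i j),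
      τ (∑ k, t k • a k) i - τ (∑ k, t k • a k) j = t i - t j)
    {β : Fin (d + 1) → ℝ} (hβ0 : ∀ i, 0 ≤ β i)
    (hβsum : ∑ i, β i = (volume (zonotope a)).toReal) :
    ∃ x ∈ zonotope a, ∀ q, ∀ ε > 0,
      volume (zonotope a ∩ {z | ∀ k ≠ q, τ z q - τ x q + ε ≤ τ z k - τ x k}) ≤
        ENNReal.ofReal (β q) := by
  have hR := isCompact_zonotope a
  have hτc : Continuous τ := τ.continuous_of_finiteDimensional
  have hτc' : ∀ k, Continuous fun z => τ z k := fun k => (continuous_apply k).comp hτc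
  let m : EuclideanSpace ℝ (Fin d) → EuclideanSpace ℝ (Fin d) → ℝ := fun x z =>
    Finset.univ.inf' Finset.univ_nonempty fun i => τ z i - τ x i
  have hm : Continuous (Function.uncurry m) := by
    refine Continuous.finset_inf'_apply Finset.univ_nonempty fun i _ => ?_
    exact ((hτc' i).comp continuous_snd).sub ((hτc' i).comp continuous_fst)
  have hmx : ∀ x, Continuous (m x) := fun x => hm.comp (Continuous.prodMk_right x)
  let Φ : EuclideanSpace ℝ (Fin d) → ℝ := fun x =>
    (∫ z in zonotope a, m x z) + ∑ i, β i * τ x i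
  have hΦ : Continuous Φ := by
    refine (continuous_parametric_integral_of_continuous hm hR).add ?_
    exact continuous_finsetSum _ fun i _ => continuous_const.mul (hτc' i)
  have hne : (zonotope a).Nonempty := ⟨0, 0, by simp, by simp⟩
  obtain ⟨x, hx, hmax⟩ := hR.exists_isMaxOn hne hΦ.continuousOn
  refine ⟨x, hx, fun q ε hε => ?_⟩
  set C := zonotope a ∩ {z | ∀ k ≠ q, τ z q - τ x q + ε ≤ τ z k - τ x k} with hC
  rcases C.eq_empty_or_nonempty with h | ⟨w, hw⟩
  · simp [h]
  have hmem {z} : z ∈ zonotope a ↔ ∀ i j, τ z i - τ z j ≤ 1 := mem_zonotope_iff hbary hτ hdiff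
  -- moving `x` by `-ε • a q` lowers the `q`-th coordinate by `ε`, relative to the others
  let c : ℝ := 1 - τ (a q) q
  have haq : ∀ i, τ (a q) i = (if i = q then 1 else 0) - c := fun i => by
    have := hdiff (Pi.single q 1) i q
    simp [Pi.single_apply] at this
    simp only [c]
    linarith
  have hstep : ∀ i, τ (x - ε • a q) i = τ x i - ε * ((if i = q then 1 else 0) - c) := fun i => by
    simp [haq]
  have hx' : x - ε • a q ∈ zonotope a := by
    rw [hmem] at hx ⊢
    intro i j
    have hij := hx i j
    rw [hstep, hstep]
    by_cases hi : i = q <;> by_cases hj : j = q <;> simp only [hi, hj, if_true, if_false] at hij ⊢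
    · linarith
    · linarith
    · have h1 := hw.2 i hi
      have h2 := hmem.mp hw.1 i q
      linarith
    · linarith
  have hCm : MeasurableSet C := by
    refine hR.isClosed.measurableSet.inter (IsClosed.measurableSet ?_)
    simp only [Set.ofPred_forall]
    refine isClosed_iInter fun k => isClosed_iInter fun _ => isClosed_le ?_ ?_
    · exact ((hτc' q).sub continuous_const).add continuous_const
    · exact (hτc' k).sub continuous_const
  have hpt : ∀ z ∈ zonotope a,
      m x z - ε * c + C.indicator (fun _ => ε) z ≤ m (x - ε • a q) z := by
    intro z hz
    refine Finset.le_inf' _ _ fun i _ => ?_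
    rw [hstep]
    have hmi : ∀ i, m x z ≤ τ z i - τ x i := fun i => Finset.inf'_le _ (Finset.mem_univ i)
    by_cases hzC : z ∈ C
    · rw [Set.indicator_of_mem hzC]
      by_cases hi : i = q
      · simp only [hi, if_true]
        linarith [hmi q]
      · simp only [hi, if_false]
        linarith [hmi q, hzC.2 i hi]
    · rw [Set.indicator_of_notMem hzC]
      split_ifs <;> linarith [hmi i]
  have hfin : volume (zonotope a) ≠ ⊤ := hR.measure_lt_top.ne
  have hint : ∀ y, IntegrableOn (m y) (zonotope a) := fun y =>
    (hmx y).continuousOn.integrableOn_compact hR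
  have hconst : IntegrableOn (fun _ => ε * c) (zonotope a) := integrableOn_const hfin
  have hind : IntegrableOn (C.indicator fun _ => ε) (zonotope a) :=
    Integrable.indicator (integrableOn_const hfin) hCm
  have hsub : IntegrableOn (fun z => m x z - ε * c) (zonotope a) := (hint x).sub hconst
  have hintle := setIntegral_mono_on
    (f := fun z => m x z - ε * c + C.indicator (fun _ => ε) z) (hsub.add hind) (hint (x - ε • a q))
    hR.isClosed.measurableSet hpt
  have hval : ∫ z in zonotope a, (m x z - ε * c + C.indicator (fun _ => ε) z) =
      (∫ z in zonotope a, m x z) - (volume (zonotope a)).toReal * (ε * c) +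
        (volume C).toReal * ε := by
    rw [integral_add hsub hind, integral_sub (hint x) hconst,
      integral_indicator hCm, Measure.restrict_restrict hCm,
      Set.inter_eq_left.mpr (hC ▸ Set.inter_subset_left)]
    simp [Measure.real]
  have hle : Φ (x - ε • a q) ≤ Φ x := hmax hx'
  have hlin : ∑ i, β i * τ (x - ε • a q) i =
      ∑ i, β i * τ x i - ε * β q + ε * c * ∑ i, β i := by
    simp only [hstep, mul_sub, Finset.sum_sub_distrib, Finset.mul_sum]
    have h1 : ∑ i, β i * (ε * if i = q then (1 : ℝ) else 0) = ε * β q := by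
      simp [mul_comm]
    rw [h1, sub_sub_eq_add_sub, add_sub_right_comm]
    congr 1
    exact Finset.sum_congr rfl fun i _ => by ring
  simp only [Φ] at hle
  rw [hlin, hβsum] at hle
  have hkey : (volume C).toReal * ε ≤ β q * ε := by
    have h3 := hval ▸ hintle
    linarith
  rw [ENNReal.le_ofReal_iff_toReal_le (measure_ne_top_of_subset Set.inter_subset_left hfin) (hβ0 q)]
  exact le_of_mul_le_mul_right hkey hε

lemma volume_coordinate_hyperplane_eq_zero
    (hdiff : ∀ (t : Fin (d + 1) → ℝ) (i j),
      τ (∑ k, t k • a k) i - τ (∑ k, t k • a k) j = t i - t j)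
    {i j : Fin (d + 1)} (hij : i ≠ j) (c : ℝ) : volume {z | τ z i - τ z j = c} = 0 := by
  let L : EuclideanSpace ℝ (Fin d) →ₗ[ℝ] ℝ := LinearMap.proj i ∘ₗ τ - LinearMap.proj j ∘ₗ τ
  have hL : ∀ z, L z = τ z i - τ z j := fun z => rfl
  have hLi : L (a i) = 1 := by
    simpa [Pi.single_apply, hij.symm, hL] using hdiff (Pi.single i 1) i j
  have hker : L.ker ≠ ⊤ := fun h => by
    have : a i ∈ L.ker := h ▸ Submodule.mem_top
    simp [hLi] at this
  have hpre : {z | τ z i - τ z j = c} = (fun z => z + -(c • a i)) ⁻¹' (L.ker : Set _) := by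
    ext z
    simp [← hL, hLi, add_neg_eq_zero]
  rw [hpre, measure_preimage_add_right]
  exact Measure.addHaar_submodule _ _ hker

/-- If the parts of a cell with positive margin all have volume at most `B`, so does the cell. -/
lemma volume_cell_le_of_margin
    (hdiff : ∀ (t : Fin (d + 1) → ℝ) (i j),
      τ (∑ k, t k • a k) i - τ (∑ k, t k • a k) j = t i - t j)
    {R : Set (EuclideanSpace ℝ (Fin d))} {x : EuclideanSpace ℝ (Fin d)} {q : Fin (d + 1)}
    {B : ENNReal}
    (h : ∀ ε > 0, volume (R ∩ {z | ∀ k ≠ q, τ z q - τ x q + ε ≤ τ z k - τ x k}) ≤ B) :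
    volume ({z | ∀ k, τ z q - τ x q ≤ τ z k - τ x k} ∩ R) ≤ B := by
  let S : ℕ → Set (EuclideanSpace ℝ (Fin d)) := fun n =>
    R ∩ {z | ∀ k ≠ q, τ z q - τ x q + 1 / ((n : ℝ) + 1) ≤ τ z k - τ x k}
  have hS : Monotone S := fun n n' hn z hz =>
    ⟨hz.1, fun k hk => by linarith [hz.2 k hk, Nat.one_div_le_one_div (α := ℝ) hn]⟩
  let N : Set (EuclideanSpace ℝ (Fin d)) :=
    ⋃ k : {k // k ≠ q}, {z | τ z k - τ z q = τ x k - τ x q}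
  have hN : volume N = 0 :=
    measure_iUnion_null fun k => volume_coordinate_hyperplane_eq_zero hdiff k.2 _
  have hsub : {z | ∀ k, τ z q - τ x q ≤ τ z k - τ x k} ∩ R ⊆ (⋃ n, S n) ∪ N := by
    rintro z ⟨hz, hzR⟩
    by_cases hzN : z ∈ N
    · exact Or.inr hzN
    have hpos : ∀ k ≠ q, 0 < (τ z k - τ x k) - (τ z q - τ x q) := fun k hk => by
      refine lt_of_le_of_ne (sub_nonneg.mpr (hz k)) fun h0 => hzN ?_
      exact Set.mem_iUnion.mpr ⟨⟨k, hk⟩, by simp only [Set.mem_ofPred_eq]; linarith⟩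
    have hev : ∀ᶠ n : ℕ in Filter.atTop, ∀ k, k ≠ q →
        1 / ((n : ℝ) + 1) < (τ z k - τ x k) - (τ z q - τ x q) := by
      rw [Filter.eventually_all]
      intro k
      by_cases hk : k = q
      · simp [hk]
      · filter_upwards [tendsto_one_div_add_atTop_nhds_zero_nat.eventually
          (gt_mem_nhds (hpos k hk))] with n hn _ using hn
    obtain ⟨n, hn⟩ := hev.exists
    exact Or.inl (Set.mem_iUnion.mpr ⟨n, hzR, fun k hk => by linarith [hn k hk]⟩)
  calc volume ({z | ∀ k, τ z q - τ x q ≤ τ z k - τ x k} ∩ R)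
      ≤ volume (⋃ n, S n) + volume N := (measure_mono hsub).trans (measure_union_le _ _)
    _ = ⨆ n, volume (S n) := by rw [hN, add_zero, hS.measure_iUnion]
    _ ≤ B := iSup_le fun n => h _ Nat.one_div_pos_of_nat

end Coordinates

/-- **Surjectivity of the illumination-volume map.** For a non-degenerate simplex
`Δ ⊂ ℝ^d` with barycenter at the origin and every nonnegative vector
`(β 0, …, β d)` with `∑ β i = vol (R_Δ)`, there is a point `x ∈ R_Δ` with
`vol ((x + cone (F i)) ∩ R_Δ) = β i` for every `i`. -/
theorem illumination_volume_map_surjective (d : ℕ)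
    (a : Fin (d + 1) → EuclideanSpace ℝ (Fin d))
    (hnondeg : LinearIndependent ℝ (fun i : Fin d => a i.succ - a 0))
    (hbary : ∑ i, a i = 0)
    (β : Fin (d + 1) → ℝ) (hβ0 : ∀ i, 0 ≤ β i)
    (hβsum : ∑ i, β i = (volume (zonotope a)).toReal) :
    ∃ x ∈ zonotope a, ∀ i : Fin (d + 1),
      volume ((x + ·) '' coneFace a i ∩ zonotope a) = ENNReal.ofReal (β i) := by
  obtain ⟨τ, hτ, hdiff⟩ := exists_vertex_coordinates hnondeg hbary
  obtain ⟨x, hx, hmargin⟩ := exists_forall_volume_margin_le hbary hτ hdiff hβ0 hβsum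
  refine ⟨x, hx, ?_⟩
  have hcone : ∀ i, (x + ·) '' coneFace a i = {z | ∀ k, τ z i - τ x i ≤ τ z k - τ x k} :=
    fun i => Set.ext fun z => mem_translate_coneFace_iff hbary hτ hdiff
  simp only [hcone]
  set V : Fin (d + 1) → Set (EuclideanSpace ℝ (Fin d)) := fun i =>
    {z | ∀ k, τ z i - τ x i ≤ τ z k - τ x k} ∩ zonotope a with hV
  have hle : ∀ i, volume (V i) ≤ ENNReal.ofReal (β i) := fun i =>
    volume_cell_le_of_margin hdiff (hmargin i)
  have hfin : ∀ i, volume (V i) ≠ ⊤ := fun i => ((hle i).trans_lt ENNReal.ofReal_lt_top).ne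
  have hle' : ∀ i ∈ Finset.univ, (volume (V i)).toReal ≤ β i := fun i _ =>
    ENNReal.toReal_le_of_le_ofReal (hβ0 i) (hle i)
  have hcover : zonotope a ⊆ ⋃ i, V i := fun z hz => by
    obtain ⟨i, hi⟩ := Finite.exists_min fun k => τ z k - τ x k
    exact Set.mem_iUnion.mpr ⟨i, hi, hz⟩
  have hsum : ∑ i, β i ≤ ∑ i, (volume (V i)).toReal := by
    rw [hβsum, ← ENNReal.toReal_sum fun i _ => hfin i]
    exact ENNReal.toReal_mono (ENNReal.sum_ne_top.mpr fun i _ => hfin i)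
      ((measure_mono hcover).trans (measure_iUnion_fintype_le _ _))
  have heq := (Finset.sum_eq_sum_iff_of_le hle').mp (le_antisymm (Finset.sum_le_sum hle') hsum)
  intro i
  rw [← heq i (Finset.mem_univ i), ENNReal.ofReal_toReal (hfin i)]
end
end
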